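/- For every rooted, ordered, labeled tree T over an alphabet Σ there exist a rooted, ordered, labeled binary tree B over the alphabet Σ ∪ {β}, where β ∉ Σ, with n_B ≤ 2·n_T, and an injective mapping g : V(T) → V(B) such that: every node of B not in the image of g is labeled β; and for all pairs of nodes v,w ∈ V(T), label(v) = label(g(v)), v ≺ w iff g(v) ≺ g(w), and v ◁ w iff g(v) ◁ g(w). Consequently, for every tree P labeled over Σ, P ⊑ T if and only if P ⊑ B. -/

import Mathlib

namespace TreeIncl

/-- Rooted, ordered, labeled trees: a label and an ordered list of children. -/
inductive OTree (α : Type) : Type where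
  | node : α → List (OTree α) → OTree α

namespace OTree

variable {α β : Type}

/-- The label of the root. -/
def label : OTree α → α
  | node a _ => a

/-- The (ordered) children subtrees of the root. -/
def children : OTree α → List (OTree α)
  | node _ cs => cs

/-- Nodes are identified with positions: lists of child indices from the root. -/
abbrev Node : Type := List ℕ

/-- The subtree rooted at a given position, if the position is valid. -/
def sub : Node → OTree α → Option (OTree α)
  | [], t => some t
  | i :: p, t =>
    match t.children[i]? with
    | some c => sub p c
    | none => none

/-- The set `V(T)` of (positions of) nodes of a tree. -/
def Pos (t : OTree α) : Set Node := {p | sub p t ≠ none}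

/-- The label of the node at position `p`. -/
def labelAt (t : OTree α) (p : Node) : Option α := (sub p t).map label

/-- `l_T`: the number of leaves of a tree. -/
def numLeaves : OTree α → ℕ
  | node _ [] => 1
  | node a (c :: cs) => numLeaves c + numLeaves (node a cs)

/-- `n_T`: the number of nodes of a tree. -/
def numNodes : OTree α → ℕ
  | node _ [] => 1
  | node a (c :: cs) => numNodes c + numNodes (node a cs)

/-- The number of leaves of the subtree rooted at position `p` (0 if `p` is invalid). -/
def leavesAt (t : OTree α) (p : Node) : ℕ := ((sub p t).map numLeaves).getD 0

/-- `v ⪯ w` : `v` is an ancestor of `w` (positions: prefix). -/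
def Anc (v w : Node) : Prop := v <+: w

/-- `v ≺ w` : `v` is a proper ancestor of `w` (positions: strict prefix). -/
def SAnc (v w : Node) : Prop := v <+: w ∧ v ≠ w

/-- `u ◁ w` : `u` is to the left of `w`
    (equivalently: `pre(u) < pre(w)` and `post(u) < post(w)`). -/
def LeftOf (u w : Node) : Prop :=
  ∃ (q : Node) (i j : ℕ) (u' w' : Node), i < j ∧ u = q ++ i :: u' ∧ w = q ++ j :: w'

/-- `u ⊴ w` : `u ◁ w` or `u ⪯ w` or `w ≺ u`. -/
def LeftOrAbove (u w : Node) : Prop := LeftOf u w ∨ Anc u w ∨ SAnc w u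

/-- The nearest common ancestor of two positions: longest common prefix. -/
def nca : Node → Node → Node
  | [], _ => []
  | _, [] => []
  | i :: u, j :: w => if i = j then i :: nca u w else []

/-- A set of nodes is deep: no node is a proper ancestor of another node in the set. -/
def DeepSet (X : Set Node) : Prop := ∀ x ∈ X, ∀ y ∈ X, ¬ SAnc x y

/-- `Deep(X)`: the elements of `X` having no proper descendant in `X`. -/
def DeepOf (X : Set Node) : Set Node := {x | x ∈ X ∧ ¬ ∃ z ∈ X, SAnc x z}

/-- `Φ(X_1, …, X_k)`: xs is a tuple with `x_i ∈ X_i` and `x_1 ◁ x_2 ◁ ⋯ ◁ x_k`. -/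
def Phi (Xs : List (Set Node)) (xs : List Node) : Prop :=
  List.Forall₂ (fun x X => x ∈ X) xs Xs ∧ xs.Chain' LeftOf

/-- `mop(X_1, …, X_k)`: the set of minimum ordered pairs. -/
def Mop (Xs : List (Set Node)) : Set (Node × Node) :=
  {p | (∃ xs, Phi Xs xs ∧ xs.head? = some p.1 ∧ xs.getLast? = some p.2) ∧
    ¬ ∃ ys y1 yk, Phi Xs ys ∧ ys.head? = some y1 ∧ ys.getLast? = some yk ∧
      ((LeftOf p.1 y1 ∧ LeftOf y1 yk ∧ LeftOrAbove yk p.2) ∨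
       (LeftOrAbove p.1 y1 ∧ LeftOf y1 yk ∧ LeftOf yk p.2))}

/-- `MopRight(Y, X)`: for `(y₁,y₂) ∈ Y`, `(y₁,x)` is in the result iff
    `(y₂,x) ∈ mop(Y|₂, X)`. -/
def MopRight (Y : Set (Node × Node)) (X : Set Node) : Set (Node × Node) :=
  {r | ∃ y2, (r.1, y2) ∈ Y ∧ (y2, r.2) ∈ Mop [Prod.snd '' Y, X]}

/-- `MopLeft(X, Y)`: for `(y₁,y₂) ∈ Y`, `(x,y₂)` is in the result iff
    `(x,y₁) ∈ mop(X, Y|₁)`. -/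
def MopLeft (X : Set Node) (Y : Set (Node × Node)) : Set (Node × Node) :=
  {r | ∃ y1, (y1, r.2) ∈ Y ∧ (r.1, y1) ∈ Mop [X, Prod.fst '' Y]}

/-- One deletion step: delete a node of the tree, making its children children of its
parent (in its place, in order); the root may be deleted when it has exactly one
child. -/
inductive DelStep : OTree α → OTree α → Prop
  | root (a : α) (t : OTree α) : DelStep (node a [t]) t
  | splice (a b : α) (pre cs post : List (OTree α)) :
      DelStep (node a (pre ++ node b cs :: post)) (node a (pre ++ cs ++ post))
  | congr (a : α) (pre post : List (OTree α)) {t t' : OTree α} :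
      DelStep t t' → DelStep (node a (pre ++ t :: post)) (node a (pre ++ t' :: post))

/-- `P ⊑ T` : `P` can be obtained from `T` by deleting nodes of `T`. -/
def Included (P T : OTree α) : Prop := Relation.ReflTransGen (fun x y => DelStep x y) T P

/-- An embedding of `P` in `T`: an injective map of nodes preserving labels,
    proper ancestorship, and the left-of relation. -/
structure IsEmb (P T : OTree α) (f : Node → Node) : Prop where
  mem : ∀ p ∈ Pos P, f p ∈ Pos T
  inj : ∀ p ∈ Pos P, ∀ q ∈ Pos P, f p = f q → p = q
  lab : ∀ p ∈ Pos P, labelAt T (f p) = labelAt P p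
  anc : ∀ p ∈ Pos P, ∀ q ∈ Pos P, (SAnc p q ↔ SAnc (f p) (f q))
  ord : ∀ p ∈ Pos P, ∀ q ∈ Pos P, (LeftOf p q ↔ LeftOf (f p) (f q))

/-- A deep embedding: no other embedding maps the root of `P` strictly deeper. -/
def IsDeepEmb (P T : OTree α) (f : Node → Node) : Prop :=
  IsEmb P T f ∧ ¬ ∃ g, IsEmb P T g ∧ SAnc (f []) (g [])

/-- `emb(P,T)`: the set of deep occurrences of `P` in `T`. -/
def emb (P T : OTree α) : Set Node := {w | ∃ f, IsDeepEmb P T f ∧ f [] = w}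

/-- `FlAt T x a q` : `q = fl(x, a)`, the first ancestor of `x` labeled `a` in `T`. -/
def FlAt (t : OTree α) (x : Node) (a : α) (q : Node) : Prop :=
  q <+: x ∧ labelAt t q = some a ∧ ∀ r, SAnc q r → r <+: x → labelAt t r ≠ some a

/-! ### Heavy leaf path decompositions -/

/-- `hv` is a heavy leaf path decomposition of `P`: for each internal node (position)
`p`, `hv p` is the index of a child with the maximum number of descendant leaves. -/
def IsHeavyDecomp (P : OTree α) (hv : Node → ℕ) : Prop :=
  ∀ p s, sub p P = some s → s.children ≠ [] →
    ∃ c, s.children[hv p]? = some c ∧ ∀ c' ∈ s.children, numLeaves c' ≤ numLeaves c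

/-- `ldepth(v)`: the number of light edges on the path from the root to `v`. -/
def ldepth (hv : Node → ℕ) (v : Node) : ℕ :=
  (List.range v.length).countP (fun n => v.getD n 0 != hv (v.take n))

/-- The light nodes on the path from the root to `v`, ordered by increasing depth
    (the root is light; a nonroot node is light iff it is not the heavy child
    of its parent). -/
def lightPrefixes (hv : Node → ℕ) (v : Node) : List Node :=
  ((List.range (v.length + 1)).map (fun n => v.take n)).filter
    (fun q => q.getLast? != some (hv q.dropLast))

/-- The position of `heavy(parent(q))` for a nonroot position `q`. -/
def heavySibPos (hv : Node → ℕ) (q : Node) : Node :=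
  q.dropLast ++ [hv q.dropLast]

/-! ### Clusters -/

/-- Two positions are adjacent in the tree (parent/child). -/
def Adj (u v : Node) : Prop := (∃ i, v = u ++ [i]) ∨ (∃ i, u = v ++ [i])

/-- `S` is (the vertex set of) a nonempty connected subgraph of `T`. -/
def Conn (T : OTree α) (S : Set Node) : Prop :=
  S.Nonempty ∧ S ⊆ Pos T ∧
    ∀ u ∈ S, ∀ v ∈ S, ∀ w, nca u v <+: w → (w <+: u ∨ w <+: v) → w ∈ S

/-- The boundary nodes of a connected subgraph `S` of `T`: nodes of `S` adjacent to a
node of `T` outside `S`, together with the root of `T` if it lies in `S`. -/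
def Boundary (T : OTree α) (S : Set Node) : Set Node :=
  {v ∈ S | (∃ u ∈ Pos T, u ∉ S ∧ Adj v u) ∨ v = []}

/-- The edges of `T` joining two nodes of `S`. -/
def EdgesIn (T : OTree α) (S : Set Node) : Set (Node × Node) :=
  {e | e.1 ∈ S ∧ e.2 ∈ S ∧ e.2 ∈ Pos T ∧ ∃ i, e.2 = e.1 ++ [i]}

/-- A cluster of `T`: a connected subgraph with at most two boundary nodes. -/
def IsCluster (T : OTree α) (S : Set Node) : Prop :=
  Conn T S ∧ (Boundary T S).encard ≤ 2

/-- A cluster partition of `T`. -/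
structure IsClusterPartition (T : OTree α) (CS : List (Set Node)) : Prop where
  cluster : ∀ S ∈ CS, IsCluster T S
  coverV : ∀ p ∈ Pos T, ∃ S ∈ CS, p ∈ S
  coverE : ∀ e ∈ EdgesIn T (Pos T), ∃ S ∈ CS, e ∈ EdgesIn T S
  disjE : CS.Pairwise (fun S₁ S₂ => EdgesIn T S₁ ∩ EdgesIn T S₂ = ∅)
  edge : ∀ S ∈ CS, (EdgesIn T S).Nonempty

/-- Binary tree: every node has at most two children. -/
def IsBinary (t : OTree α) : Prop := ∀ p s, sub p t = some s → s.children.length ≤ 2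

/-- Relabeling of a tree. -/
def omap (f : α → β) : OTree α → OTree β
  | node a cs => node (f a) (cs.attach.map (fun c => omap f c.1))
termination_by t => sizeOf t
decreasing_by
  have := List.sizeOf_lt_of_mem c.2
  simp only [OTree.node.sizeOf_spec]
  omega


lemma omap_node (f : α → β) (a : α) (cs : List (OTree α)) :
    omap f (node a cs) = node (f a) (cs.map (omap f)) := by
  simp [omap]

/-! ### Deletion in forests -/

/-- One deletion step in an ordered forest, in which roots may be deleted freely. -/
inductive ForestStep : List (OTree α) → List (OTree α) → Prop
  | splice (b : α) (pre cs post : List (OTree α)) :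
      ForestStep (pre ++ node b cs :: post) (pre ++ cs ++ post)
  | congr (a : α) (pre post : List (OTree α)) {cs cs' : List (OTree α)} :
      ForestStep cs cs' → ForestStep (pre ++ node a cs :: post) (pre ++ node a cs' :: post)

/-- A forest can be turned into another one by deleting nodes. -/
abbrev ForestReduces : List (OTree α) → List (OTree α) → Prop :=
  Relation.ReflTransGen ForestStep

lemma ForestStep.append {F F' : List (OTree α)} (h : ForestStep F F') (l r : List (OTree α)) :
    ForestStep (l ++ F ++ r) (l ++ F' ++ r) := by
  cases h with
  | splice b pre cs post =>
    simpa using ForestStep.splice b (l ++ pre) cs (post ++ r)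
  | congr a pre post h =>
    simpa using ForestStep.congr a (l ++ pre) (post ++ r) h

lemma ForestReduces.append {F F' : List (OTree α)} (h : ForestReduces F F')
    (l r : List (OTree α)) : ForestReduces (l ++ F ++ r) (l ++ F' ++ r) :=
  Relation.ReflTransGen.lift (fun F => l ++ F ++ r)
    (fun _ _ (h : ForestStep _ _) => h.append l r) _ _ h

lemma ForestReduces.node {cs cs' : List (OTree α)} (h : ForestReduces cs cs') (a : α) :
    ForestReduces [node a cs] [node a cs'] :=
  Relation.ReflTransGen.lift (fun F => [OTree.node a F])
    (fun _ _ (h : ForestStep _ _) => h.congr a [] []) _ _ h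

lemma DelStep.forestStep {t t' : OTree α} (h : DelStep t t') : ForestStep [t] [t'] := by
  induction h with
  | root a t => simpa using ForestStep.splice a [] [t] []
  | splice a b pre cs post => exact (ForestStep.splice b pre cs post).congr a [] []
  | congr a pre post _ ih =>
    have := ih.append pre post
    simp only [List.append_assoc, List.singleton_append] at this
    exact this.congr a [] []

lemma ForestStep.delStep {F F' : List (OTree α)} (h : ForestStep F F') (a : α) :
    DelStep (node a F) (node a F') := by
  induction h generalizing a with
  | splice b pre cs post => exact .splice a b pre cs post
  | congr b pre post _ ih => exact .congr a pre post (ih b)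

lemma ForestStep.of_singleton {t : OTree α} {F : List (OTree α)} (h : ForestStep [t] F) :
    (∃ a, t = node a F) ∨ ∃ t', F = [t'] ∧ DelStep t t' := by
  generalize hG : [t] = G at h
  cases h with
  | splice b pre cs post =>
    obtain ⟨rfl, rfl, rfl⟩ : pre = [] ∧ t = OTree.node b cs ∧ post = [] := by
      cases pre <;> simp_all
    exact .inl ⟨b, by simp⟩
  | @congr b pre post cs cs' h =>
    obtain ⟨rfl, rfl, rfl⟩ : pre = [] ∧ t = OTree.node b cs ∧ post = [] := by
      cases pre <;> simp_all
    exact .inr ⟨_, rfl, h.delStep b⟩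

/-- Deleting a root early can be simulated by keeping it until it has a single child. -/
lemma ForestReduces.exists_included {T : OTree α} {F : List (OTree α)}
    (h : ForestReduces [T] F) :
    (∃ t, F = [t] ∧ Included t T) ∨ ∃ a, Included (OTree.node a F) T := by
  induction h with
  | refl => exact .inl ⟨T, rfl, .refl⟩
  | tail _ hstep ih =>
    rcases ih with ⟨t, rfl, ht⟩ | ⟨a, ha⟩
    · rcases hstep.of_singleton with ⟨a, rfl⟩ | ⟨t', rfl, h'⟩
      · exact .inr ⟨a, ht⟩
      · exact .inl ⟨t', rfl, ht.tail h'⟩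
    · exact .inr ⟨a, ha.tail (hstep.delStep a)⟩

lemma included_iff_forestReduces {P T : OTree α} : Included P T ↔ ForestReduces [T] [P] := by
  refine ⟨fun h => Relation.ReflTransGen.lift (fun t => [t])
    (fun _ _ (h : DelStep _ _) => h.forestStep) _ _ h, fun h => ?_⟩
  rcases h.exists_included with ⟨t, ht, h⟩ | ⟨a, h⟩
  · obtain rfl : P = t := by simpa using ht
    exact h
  · exact h.tail (.root a P)

lemma ForestStep.map_omap (f : α → β) {F F' : List (OTree α)} (h : ForestStep F F') :
    ForestStep (F.map (omap f)) (F'.map (omap f)) := by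
  induction h with
  | splice b pre cs post =>
    simpa [omap_node] using
      ForestStep.splice (f b) (pre.map (omap f)) (cs.map (omap f)) (post.map (omap f))
  | congr a pre post _ ih =>
    simpa [omap_node] using ih.congr (f a) (pre.map (omap f)) (post.map (omap f))

/-! ### Erasing unlabeled nodes -/

mutual

/-- The forest obtained by deleting all nodes labeled `none` from a tree. -/
def eraseNone : OTree (Option α) → List (OTree α)
  | node none cs => eraseNoneForest cs
  | node (some a) cs => [node a (eraseNoneForest cs)]

/-- The forest obtained by deleting all nodes labeled `none` from a forest. -/
def eraseNoneForest : List (OTree (Option α)) → List (OTree α)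
  | [] => []
  | c :: cs => eraseNone c ++ eraseNoneForest cs

end

lemma eraseNoneForest_append (F G : List (OTree (Option α))) :
    eraseNoneForest (F ++ G) = eraseNoneForest F ++ eraseNoneForest G := by
  induction F with
  | nil => simp [eraseNoneForest]
  | cons c F ih => simp [eraseNoneForest, ih]

lemma ForestStep.eraseNoneForest {F F' : List (OTree (Option α))} (h : ForestStep F F') :
    ForestReduces (eraseNoneForest F) (eraseNoneForest F') := by
  induction h with
  | splice b pre cs post =>
    simp only [eraseNoneForest_append, OTree.eraseNoneForest]
    cases b with
    | none => simpa [eraseNone] using Relation.ReflTransGen.refl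
    | some b =>
      simpa [eraseNone] using Relation.ReflTransGen.single
        (ForestStep.splice b (OTree.eraseNoneForest pre) (OTree.eraseNoneForest cs)
          (OTree.eraseNoneForest post))
  | congr a pre post _ ih =>
    simp only [eraseNoneForest_append, OTree.eraseNoneForest]
    cases a with
    | none => simpa [eraseNone] using ih.append _ _
    | some a => simpa [eraseNone] using (ih.node a).append _ _

lemma ForestReduces.eraseNoneForest {F F' : List (OTree (Option α))} (h : ForestReduces F F') :
    ForestReduces (eraseNoneForest F) (eraseNoneForest F') := by
  induction h with
  | refl => exact .refl
  | tail _ h ih => exact ih.trans h.eraseNoneForest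

mutual

lemma eraseNone_omap_some : ∀ t : OTree α, eraseNone (omap some t) = [t]
  | node a cs => by
    rw [omap_node, eraseNone, eraseNoneForest_map_omap_some cs]

lemma eraseNoneForest_map_omap_some :
    ∀ F : List (OTree α), eraseNoneForest (F.map (omap some)) = F
  | [] => by simp [eraseNoneForest]
  | c :: cs => by
    simp [eraseNoneForest, eraseNone_omap_some c, eraseNoneForest_map_omap_some cs]

end

/-! ### The binary tree -/

mutual

/-- The binary tree in which each list of siblings is spread along a path of nodes labeled
`none`. -/
def toBinary : OTree α → OTree (Option α)
  | node a cs => node (some a) (toBinaryForest cs)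

/-- The children of the node on the path of new nodes from which the given siblings hang. -/
def toBinaryForest : List (OTree α) → List (OTree (Option α))
  | [] => []
  | c :: cs => [toBinary c, node none (toBinaryForest cs)]

end

/-- The position in `toBinary T` of the node of `T` at a given position. -/
def binaryPos : Node → Node
  | [] => []
  | i :: p => List.replicate i 1 ++ 0 :: binaryPos p

lemma label_toBinary (t : OTree α) : (toBinary t).label = some t.label := by
  cases t; simp [toBinary, label]

mutual

lemma eraseNone_toBinary : ∀ t : OTree α, eraseNone (toBinary t) = [t]
  | node a cs => by
    rw [toBinary, eraseNone, eraseNoneForest_toBinaryForest cs]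

lemma eraseNoneForest_toBinaryForest :
    ∀ F : List (OTree α), eraseNoneForest (toBinaryForest F) = F
  | [] => by simp [toBinaryForest, eraseNoneForest]
  | c :: cs => by
    simp [toBinaryForest, eraseNoneForest, eraseNone, eraseNone_toBinary c,
      eraseNoneForest_toBinaryForest cs]

end

mutual

lemma forestReduces_toBinary : ∀ t : OTree α, ForestReduces [toBinary t] [omap some t]
  | node a cs => by
    rw [toBinary, omap_node]
    exact (forestReduces_toBinaryForest cs).node _

lemma forestReduces_toBinaryForest :
    ∀ F : List (OTree α), ForestReduces (toBinaryForest F) (F.map (omap some))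
  | [] => by simpa [toBinaryForest] using Relation.ReflTransGen.refl
  | c :: cs => by
    have h₁ : ForestReduces (toBinaryForest (c :: cs)) (toBinary c :: toBinaryForest cs) := by
      simpa [toBinaryForest] using Relation.ReflTransGen.single
        (ForestStep.splice none [toBinary c] (toBinaryForest cs) [])
    have h₂ := (forestReduces_toBinary c).append [] (toBinaryForest cs)
    have h₃ := (forestReduces_toBinaryForest cs).append [omap some c] []
    simp only [List.nil_append, List.append_nil, List.singleton_append] at h₂ h₃
    exact (h₁.trans h₂).trans h₃

end

lemma included_iff_included_toBinary (P T : OTree α) :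
    Included P T ↔ Included (omap some P) (toBinary T) := by
  rw [included_iff_forestReduces, included_iff_forestReduces]
  constructor
  · intro h
    exact (forestReduces_toBinary T).trans
      (Relation.ReflTransGen.lift (List.map (omap some))
        (fun _ _ (h : ForestStep _ _) => h.map_omap some) _ _ h)
  · intro h
    simpa [eraseNoneForest, eraseNone_toBinary, eraseNone_omap_some] using h.eraseNoneForest

mutual

lemma numNodes_toBinary : ∀ t : OTree α, numNodes (toBinary t) + 1 = 2 * numNodes t
  | node a cs => by
    rw [toBinary]
    exact numNodes_toBinaryForest cs (some a) a

lemma numNodes_toBinaryForest : ∀ (F : List (OTree α)) (x : Option α) (a : α),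
    numNodes (node x (toBinaryForest F)) + 1 = 2 * numNodes (node a F)
  | [], x, a => by simp [toBinaryForest, numNodes]
  | c :: cs, x, a => by
    have h₁ := numNodes_toBinary c
    have h₂ := numNodes_toBinaryForest cs none a
    simp only [toBinaryForest, numNodes]
    omega

end

lemma sub_nil (t : OTree α) : sub [] t = some t := by
  simp [sub]

lemma sub_cons_node (i : ℕ) (p : Node) (a : α) (cs : List (OTree α)) :
    sub (i :: p) (node a cs) = cs[i]?.bind (sub p) := by
  simp only [sub, children]
  cases cs[i]? <;> rfl

lemma sub_cons_node_toBinaryForest (q : Node) (x : Option α) (k : ℕ) (cs : List (OTree α)) :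
    sub (List.replicate k 1 ++ 0 :: q) (node x (toBinaryForest cs)) =
      cs[k]?.bind fun c => sub q (toBinary c) := by
  induction k generalizing x cs with
  | zero => cases cs <;> simp [sub_cons_node, toBinaryForest]
  | succ k ih =>
    cases cs with
    | nil => simp [List.replicate_succ, sub_cons_node, toBinaryForest]
    | cons c cs => simp [List.replicate_succ, sub_cons_node, toBinaryForest, ih]

lemma sub_binaryPos (p : Node) (t : OTree α) :
    sub (binaryPos p) (toBinary t) = (sub p t).map toBinary := by
  induction p generalizing t with
  | nil => simp [binaryPos, sub_nil]
  | cons i p ih =>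
    obtain ⟨a, cs⟩ := t
    rw [binaryPos, toBinary, sub_cons_node_toBinaryForest, sub_cons_node]
    cases cs[i]? <;> simp [ih]

lemma length_children_le_of_sub_toBinaryForest (p : Node) (x : Option α) (cs : List (OTree α))
    (s : OTree (Option α)) (h : sub p (node x (toBinaryForest cs)) = some s) :
    s.children.length ≤ 2 := by
  induction p generalizing x cs with
  | nil =>
    obtain rfl : node x (toBinaryForest cs) = s := by simpa [sub_nil] using h
    cases cs <;> simp [children, toBinaryForest]
  | cons i p ih =>
    rw [sub_cons_node] at h
    cases cs with
    | nil => simp [toBinaryForest] at h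
    | cons c cs =>
      obtain ⟨a, ds⟩ := c
      match i with
      | 0 => exact ih (some a) ds (by simpa [toBinaryForest, toBinary] using h)
      | 1 => exact ih none cs (by simpa [toBinaryForest] using h)
      | i + 2 => simp [toBinaryForest] at h

lemma isBinary_toBinary (t : OTree α) : IsBinary (toBinary t) := by
  obtain ⟨a, cs⟩ := t
  intro p s h
  rw [toBinary] at h
  exact length_children_le_of_sub_toBinaryForest p _ _ s h

lemma eq_binaryPos_or_label_eq_none (q : Node) (x : Option α) (cs : List (OTree α))
    (s : OTree (Option α)) (h : sub q (node x (toBinaryForest cs)) = some s) :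
    q = [] ∨ s.label = none ∨
      ∃ i p c, cs[i]? = some c ∧ p ∈ Pos c ∧ q = binaryPos (i :: p) := by
  induction q generalizing x cs with
  | nil => exact .inl rfl
  | cons k q ih =>
    rw [sub_cons_node] at h
    cases cs with
    | nil => simp [toBinaryForest] at h
    | cons c cs =>
      match k with
      | 0 =>
        obtain ⟨a, ds⟩ := c
        rcases ih (some a) ds (by simpa [toBinaryForest, toBinary] using h) with
          rfl | hs | ⟨i, p, d, hd, hp, rfl⟩
        · exact .inr <| .inr ⟨0, [], node a ds, by simp, by simp [Pos, sub_nil],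
            by simp [binaryPos]⟩
        · exact .inr <| .inl hs
        · refine .inr <| .inr ⟨0, i :: p, node a ds, by simp, ?_, by simp [binaryPos]⟩
          simpa [Pos, sub_cons_node, hd] using hp
      | 1 =>
        have h : sub q (node none (toBinaryForest cs)) = some s := by
          simpa [toBinaryForest] using h
        rcases ih none cs h with rfl | hs | ⟨i, p, d, hd, hp, rfl⟩
        · rw [sub_nil, Option.some_inj] at h
          exact .inr <| .inl (by rw [← h]; rfl)
        · exact .inr <| .inl hs
        · exact .inr <| .inr ⟨i + 1, p, d, by simpa using hd, hp,
            by simp [binaryPos, List.replicate_succ]⟩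
      | k + 2 => simp [toBinaryForest] at h

lemma labelAt_toBinary_of_forall_ne (t : OTree α) (q : Node) (hq : q ∈ Pos (toBinary t))
    (hne : ∀ p ∈ Pos t, binaryPos p ≠ q) : labelAt (toBinary t) q = some none := by
  obtain ⟨s, hs⟩ := Option.ne_none_iff_exists'.mp hq
  obtain ⟨a, cs⟩ := t
  have hs' := hs
  rw [toBinary] at hs'
  rcases eq_binaryPos_or_label_eq_none q _ cs s hs' with rfl | hl | ⟨i, p, c, hc, hp, rfl⟩
  · exact absurd rfl (hne [] (by simp [Pos, sub_nil]))
  · simp [labelAt, hs, hl]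
  · refine absurd rfl (hne (i :: p) ?_)
    simpa [Pos, sub_cons_node, hc] using hp

/-! ### Comparing positions -/

lemma SAnc.exists_append {p q : Node} (h : SAnc p q) : ∃ i r, q = p ++ i :: r := by
  obtain ⟨⟨r, rfl⟩, hne⟩ := h
  cases r with
  | nil => simp at hne
  | cons i r => exact ⟨i, r, rfl⟩

lemma sAnc_append_cons (p : Node) (i : ℕ) (r : Node) : SAnc p (p ++ i :: r) :=
  ⟨List.prefix_append _ _, by simp⟩

lemma LeftOf.append_left {p q : Node} (h : LeftOf p q) (r : Node) :
    LeftOf (r ++ p) (r ++ q) := by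
  obtain ⟨s, i, j, u, w, hij, rfl, rfl⟩ := h
  exact ⟨r ++ s, i, j, u, w, hij, by simp, by simp⟩

lemma SAnc.append_left {p q : Node} (h : SAnc p q) (r : Node) : SAnc (r ++ p) (r ++ q) := by
  obtain ⟨i, s, rfl⟩ := h.exists_append
  simpa using sAnc_append_cons (r ++ p) i s

lemma eq_or_sAnc_or_leftOf (p q : Node) :
    p = q ∨ SAnc p q ∨ SAnc q p ∨ LeftOf p q ∨ LeftOf q p := by
  induction p generalizing q with
  | nil =>
    cases q with
    | nil => exact .inl rfl
    | cons j q => exact .inr <| .inl (sAnc_append_cons [] j q)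
  | cons i p ih =>
    cases q with
    | nil => exact .inr <| .inr <| .inl (sAnc_append_cons [] i p)
    | cons j q =>
      rcases lt_trichotomy i j with h | rfl | h
      · exact .inr <| .inr <| .inr <| .inl ⟨[], i, j, p, q, h, rfl, rfl⟩
      · rcases ih q with rfl | h | h | h | h
        · exact .inl rfl
        · exact .inr <| .inl (h.append_left [i])
        · exact .inr <| .inr <| .inl (h.append_left [i])
        · exact .inr <| .inr <| .inr <| .inl (h.append_left [i])
        · exact .inr <| .inr <| .inr <| .inr (h.append_left [i])
      · exact .inr <| .inr <| .inr <| .inr ⟨[], j, i, q, p, h, rfl, rfl⟩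

lemma SAnc.asymm {p q : Node} (h : SAnc p q) : ¬ SAnc q p :=
  fun h' => h.2 (h.1.eq_of_length_le h'.1.length_le)

lemma LeftOf.not_prefix {p q : Node} (h : LeftOf p q) : ¬ p <+: q ∧ ¬ q <+: p := by
  obtain ⟨s, i, j, u, w, hij, rfl, rfl⟩ := h
  simp [List.prefix_append_right_inj, List.cons_prefix_cons, hij.ne, hij.ne']

lemma LeftOf.lt {p q : Node} (h : LeftOf p q) : p < q := by
  obtain ⟨s, i, j, u, w, hij, rfl, rfl⟩ := h
  exact List.append_left_lt (List.Lex.rel hij)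

lemma LeftOf.asymm {p q : Node} (h : LeftOf p q) : ¬ LeftOf q p :=
  fun h' => lt_asymm h.lt h'.lt

lemma binaryPos_append (p q : Node) : binaryPos (p ++ q) = binaryPos p ++ binaryPos q := by
  induction p with
  | nil => simp [binaryPos]
  | cons i p ih => simp [binaryPos, ih]

lemma SAnc.binaryPos {p q : Node} (h : SAnc p q) : SAnc (binaryPos p) (binaryPos q) := by
  obtain ⟨i, r, rfl⟩ := h.exists_append
  rw [binaryPos_append]
  exact ⟨List.prefix_append _ _, by simp [OTree.binaryPos]⟩

lemma LeftOf.binaryPos {p q : Node} (h : LeftOf p q) : LeftOf (binaryPos p) (binaryPos q) := by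
  obtain ⟨s, i, j, u, w, hij, rfl, rfl⟩ := h
  obtain ⟨k, rfl⟩ := Nat.exists_eq_add_of_lt hij
  rw [binaryPos_append, binaryPos_append]
  refine LeftOf.append_left ⟨List.replicate i 1, 0, 1, OTree.binaryPos u,
    List.replicate k 1 ++ 0 :: OTree.binaryPos w, one_pos, rfl, ?_⟩ _
  rw [OTree.binaryPos, add_assoc, List.replicate_add, List.replicate_succ, List.append_assoc,
    List.cons_append]

lemma sAnc_binaryPos_iff (p q : Node) : SAnc p q ↔ SAnc (binaryPos p) (binaryPos q) := by
  refine ⟨SAnc.binaryPos, fun h => ?_⟩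
  rcases eq_or_sAnc_or_leftOf p q with rfl | h' | h' | h' | h'
  · exact absurd rfl h.2
  · exact h'
  · exact absurd h h'.binaryPos.asymm
  · exact absurd h.1 h'.binaryPos.not_prefix.1
  · exact absurd h.1 h'.binaryPos.not_prefix.2

lemma leftOf_binaryPos_iff (p q : Node) : LeftOf p q ↔ LeftOf (binaryPos p) (binaryPos q) := by
  refine ⟨LeftOf.binaryPos, fun h => ?_⟩
  rcases eq_or_sAnc_or_leftOf p q with rfl | h' | h' | h' | h'
  · exact absurd h h.asymm
  · exact absurd h'.binaryPos.1 h.not_prefix.1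
  · exact absurd h'.binaryPos.1 h.not_prefix.2
  · exact h'
  · exact absurd h h'.binaryPos.asymm

lemma binaryPos_injective : Function.Injective binaryPos := by
  intro p q h
  rcases eq_or_sAnc_or_leftOf p q with h' | h' | h' | h' | h'
  · exact h'
  · exact absurd h h'.binaryPos.2
  · exact absurd h.symm h'.binaryPos.2
  · exact absurd (h ▸ List.prefix_rfl) h'.binaryPos.not_prefix.1
  · exact absurd (h ▸ List.prefix_rfl) h'.binaryPos.not_prefix.1

/-- Every tree `T` over `Σ` can be turned into a binary tree `B`
over `Σ ∪ {β}` (here `Option α`, with `none` playing the role of `β ∉ Σ`) with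
`n_B ≤ 2·n_T` and an injective mapping `g` preserving labels, the proper-ancestor
relation and the left-of relation, with all nodes outside the image of `g` labeled
`β`; consequently `P ⊑ T` iff `P ⊑ B` for every `P` over `Σ`. -/
theorem exists_binary_tree_equivalent {α : Type} (T : OTree α) :
    ∃ (B : OTree (Option α)) (g : Node → Node),
      IsBinary B ∧
      numNodes B ≤ 2 * numNodes T ∧
      (∀ p ∈ Pos T, g p ∈ Pos B) ∧
      (∀ p ∈ Pos T, ∀ q ∈ Pos T, g p = g q → p = q) ∧
      (∀ q ∈ Pos B, (∀ p ∈ Pos T, g p ≠ q) → labelAt B q = some none) ∧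
      (∀ p ∈ Pos T, labelAt B (g p) = (labelAt T p).map some) ∧
      (∀ p ∈ Pos T, ∀ q ∈ Pos T, (SAnc p q ↔ SAnc (g p) (g q))) ∧
      (∀ p ∈ Pos T, ∀ q ∈ Pos T, (LeftOf p q ↔ LeftOf (g p) (g q))) ∧
      (∀ P : OTree α, Included P T ↔ Included (omap some P) B) := by
  refine ⟨toBinary T, binaryPos, isBinary_toBinary T, ?_, ?_,
    fun p _ q _ h => binaryPos_injective h, labelAt_toBinary_of_forall_ne T, ?_,
    fun p _ q _ => sAnc_binaryPos_iff p q, fun p _ q _ => leftOf_binaryPos_iff p q,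
    fun P => included_iff_included_toBinary P T⟩
  · have := numNodes_toBinary T
    omega
  · intro p hp
    simpa [Pos, sub_binaryPos] using hp
  · intro p _
    rw [labelAt, labelAt, sub_binaryPos, Option.map_map, Option.map_map]
    exact congrArg (fun f => (sub p T).map f) (funext label_toBinary)

end OTree

end TreeIncl
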